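/- Every g×5 real matrix of tropical rank 3 has Kapranov rank 3. -/

import Mathlib

open scoped Classical

noncomputable section

/-- The field of generalized Puiseux series: Hahn series with real exponents
and complex coefficients. -/
abbrev Ktilde : Type := HahnSeries ℝ ℂ

/-- The order (least exponent) of a generalized Puiseux series. -/
def ord (x : Ktilde) : ℝ := x.order

/-- The leading coefficient of a generalized Puiseux series. -/
def orc (x : Ktilde) : ℂ := x.coeff x.order

/-- The tropical determinant of a square real matrix. -/
def tropDet {r : ℕ} (A : Matrix (Fin r) (Fin r) ℝ) : ℝ :=
  sInf {v | ∃ σ : Equiv.Perm (Fin r), v = ∑ i, A i (σ i)}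

/-- A square real matrix is tropically singular if the minimum in its
tropical determinant is attained by at least two permutations. -/
def TropSingular {r : ℕ} (A : Matrix (Fin r) (Fin r) ℝ) : Prop :=
  ∃ σ τ : Equiv.Perm (Fin r), σ ≠ τ ∧
    (∑ i, A i (σ i)) = tropDet A ∧ (∑ i, A i (τ i)) = tropDet A

/-- The tropical rank: the largest size of a tropically nonsingular square
submatrix. -/
def tropRank {m n : ℕ} (M : Matrix (Fin m) (Fin n) ℝ) : ℕ :=
  sSup {r | ∃ ri : Fin r → Fin m, ∃ ci : Fin r → Fin n,
    Function.Injective ri ∧ Function.Injective ci ∧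
    ¬ TropSingular (M.submatrix ri ci)}

/-- `F` is a lift of the real matrix `M`: all entries of `F` are nonzero
generalized Puiseux series whose orders are the entries of `M`. -/
def IsLift {m n : ℕ} (F : Matrix (Fin m) (Fin n) Ktilde)
    (M : Matrix (Fin m) (Fin n) ℝ) : Prop :=
  ∀ i j, F i j ≠ 0 ∧ ord (F i j) = M i j

/-- The Kapranov rank: the smallest classical rank of a lift of `M` to the
field of generalized Puiseux series. -/
def kapRank {m n : ℕ} (M : Matrix (Fin m) (Fin n) ℝ) : ℕ :=
  sInf {r | ∃ F : Matrix (Fin m) (Fin n) Ktilde, IsLift F M ∧ F.rank ≤ r}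

/-- The Barvinok rank: the smallest `r` such that `M` is the entrywise
(min-plus) sum of `r` tropical products of a column by a row. -/
def barvRank {m n : ℕ} (M : Matrix (Fin m) (Fin n) ℝ) : ℕ :=
  sInf {r | ∃ (A : Fin r → Fin m → ℝ) (B : Fin r → Fin n → ℝ),
    ∀ i j, IsLeast {v | ∃ l : Fin r, v = A l i + B l j} (M i j)}

theorem exists_abs_sub_le {ι κ : Type*} [Finite ι] [Finite κ] (a : ι → κ → ℝ) :
    ∃ C : ℝ, 0 ≤ C ∧ ∀ i j k, |a i k - a i j| ≤ C := by
  obtain ⟨C, hC⟩ := (Set.finite_range fun p : ι × κ × κ => |a p.1 p.2.2 - a p.1 p.2.1|).bddAbove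
  refine ⟨max C 0, le_max_right _ _, fun i j k => le_max_of_le_left (hC ⟨(i, j, k), rfl⟩)⟩

/-- The Shapley operator attached to a real matrix. -/
def shapley {ι κ : Type*} [Fintype ι] [Nonempty ι] [Fintype κ] [Nontrivial κ]
    (a : ι → κ → ℝ) (v : κ → ℝ) (j : κ) : ℝ :=
  Finset.univ.sup' Finset.univ_nonempty fun i =>
    (Finset.univ.erase j).inf' Finset.univ_nontrivial.erase_nonempty fun k => a i k - a i j + v k

section Shapley

variable {ι κ : Type*} [Fintype ι] [Nonempty ι] [Fintype κ] [Nontrivial κ] (a : ι → κ → ℝ)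

theorem shapley_le_iff (v : κ → ℝ) (j : κ) (r : ℝ) :
    shapley a v j ≤ r ↔ ∀ i, ∃ k, k ≠ j ∧ a i k - a i j + v k ≤ r := by
  simp [shapley, Finset.inf'_le_iff]

theorem lt_shapley_iff (v : κ → ℝ) (j : κ) (r : ℝ) :
    r < shapley a v j ↔ ∃ i, ∀ k, k ≠ j → r < a i k - a i j + v k := by
  simp [shapley, Finset.lt_sup'_iff, Finset.lt_inf'_iff]

theorem shapley_sub_le (v w : κ → ℝ) (j : κ) : shapley a v j - shapley a w j ≤ dist v w := by
  rw [sub_le_iff_le_add, shapley_le_iff]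
  intro i
  obtain ⟨k, hk, h⟩ := (shapley_le_iff a w j _).1 le_rfl i
  refine ⟨k, hk, ?_⟩
  have h₁ := dist_le_pi_dist v w k
  rw [Real.dist_eq] at h₁
  linarith [le_abs_self (v k - w k)]

theorem lipschitzWith_shapley : LipschitzWith 1 (shapley a) := by
  refine LipschitzWith.of_dist_le_mul fun v w => ?_
  rw [NNReal.coe_one, one_mul, dist_pi_le_iff dist_nonneg]
  intro j
  rw [Real.dist_eq, abs_le]
  have h₁ := shapley_sub_le a v w j
  have h₂ := shapley_sub_le a w v j
  rw [dist_comm] at h₂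
  constructor <;> linarith

theorem exists_shapley_smul_eq {t : ℝ} (h₀ : 0 < t) (h₁ : t < 1) :
    ∃ u : κ → ℝ, t • shapley a u = u := by
  have hc : ContractingWith ⟨t, h₀.le⟩ fun u : κ → ℝ => t • shapley a u := by
    refine ⟨by exact_mod_cast h₁, LipschitzWith.of_dist_le_mul fun v w => ?_⟩
    rw [dist_smul₀, Real.norm_of_nonneg h₀.le]
    have := (lipschitzWith_shapley a).dist_le_mul v w
    simp only [NNReal.coe_one, one_mul] at this
    exact mul_le_mul_of_nonneg_left this h₀.le
  exact ⟨hc.fixedPoint, hc.fixedPoint_isFixedPt⟩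

theorem shapley_le_add {C : ℝ} (hC : ∀ i j k, |a i k - a i j| ≤ C) (v : κ → ℝ) {j k : κ}
    (h : k ≠ j) : shapley a v j ≤ v k + C :=
  (shapley_le_iff a v j _).2 fun i => ⟨k, h, by linarith [(abs_le.1 (hC i j k)).2]⟩

theorem abs_le_of_shapley_smul_eq {C t : ℝ} (hC₀ : 0 ≤ C) (hC : ∀ i j k, |a i k - a i j| ≤ C)
    (h₀ : 0 < t) (h₁ : t < 1) {u : κ → ℝ} (hu : t • shapley a u = u) {p q : κ} (hp : 0 < u p)
    (hq : u q ≤ 0) (j : κ) : |u j| ≤ C := by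
  have hu' : ∀ j, t * shapley a u j = u j := fun j => congrFun hu j
  obtain ⟨k, hk⟩ := Finite.exists_min u
  have hk₀ : u k ≤ 0 := (hk q).trans hq
  have hkp : k ≠ p := by rintro rfl; linarith
  have hlow : -C ≤ u k := by
    have h := shapley_le_add a hC u hkp
    have h' : 0 < shapley a u p := by
      have := hu' p
      by_contra! hneg
      nlinarith
    linarith
  refine abs_le.2 ⟨hlow.trans (hk j), ?_⟩
  rcases eq_or_ne k j with rfl | hkj
  · linarith
  · have h := shapley_le_add a hC u hkj
    rw [← hu' j]
    nlinarith

/-- A real matrix either has tropically dependent columns, or its columns can be rescaled so that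
each column contains the unique minimum of some row. -/
theorem exists_dependency_or_exists_unique_min :
    (∃ v : κ → ℝ, ∀ i j, ∃ k, k ≠ j ∧ a i k + v k ≤ a i j + v j) ∨
      ∃ v : κ → ℝ, ∀ j, ∃ i, ∀ k, k ≠ j → a i j + v j < a i k + v k := by
  by_contra! ⟨hdep, huniq⟩
  have hdep' : ∀ v : κ → ℝ, ¬ ∀ j, shapley a v j ≤ v j := by
    intro v hv
    obtain ⟨i, j, h⟩ := hdep v
    obtain ⟨k, hk, hk'⟩ := (shapley_le_iff a v j _).1 (hv j) i
    linarith [h k hk]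
  have huniq' : ∀ v : κ → ℝ, ¬ ∀ j, v j < shapley a v j := by
    intro v hv
    obtain ⟨j, h⟩ := huniq v
    obtain ⟨i, hi⟩ := (lt_shapley_iff a v j _).1 (hv j)
    obtain ⟨k, hk, hk'⟩ := h i
    linarith [hi k hk]
  obtain ⟨C, hC₀, hC⟩ := exists_abs_sub_le a
  let t : ℕ → ℝ := fun n => 1 - 1 / ((n : ℝ) + 2)
  have ht₀ : ∀ n, 0 < t n := fun n => by
    have : 1 / ((n : ℝ) + 2) < 1 := by
      rw [div_lt_one (by positivity)]; linarith [n.cast_nonneg (α := ℝ)]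
    simp only [t]; linarith
  have ht₁ : ∀ n, t n < 1 := fun n => by
    have : 0 < 1 / ((n : ℝ) + 2) := by positivity
    simp only [t]; linarith
  have htlim : Filter.Tendsto t Filter.atTop (nhds 1) := by
    have h : Filter.Tendsto (fun n : ℕ => 1 / ((n : ℝ) + 2)) Filter.atTop (nhds 0) :=
      tendsto_const_nhds.div_atTop
        (Filter.tendsto_atTop_add_const_right _ _ tendsto_natCast_atTop_atTop)
    simpa [t] using tendsto_const_nhds.sub h
  choose u hu using fun n => exists_shapley_smul_eq a (ht₀ n) (ht₁ n)
  have hu' : ∀ n j, t n * shapley a (u n) j = u n j := fun n j => congrFun (hu n) j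
  have hbound : ∀ n, u n ∈ Metric.closedBall (0 : κ → ℝ) C := by
    intro n
    have hp : ∃ p, 0 < u n p := by
      by_contra! h
      refine hdep' (u n) fun j => ?_
      have h₁ := hu' n j
      have h₂ := h j
      by_contra! h₃
      nlinarith [ht₀ n, ht₁ n]
    have hq : ∃ q, u n q ≤ 0 := by
      by_contra! h
      refine huniq' (u n) fun j => ?_
      have h₁ := hu' n j
      have h₂ := h j
      by_contra! h₃
      nlinarith [ht₀ n, ht₁ n]
    obtain ⟨p, hp⟩ := hp
    obtain ⟨q, hq⟩ := hq
    rw [mem_closedBall_zero_iff, pi_norm_le_iff_of_nonneg hC₀]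
    exact fun j => abs_le_of_shapley_smul_eq a hC₀ hC (ht₀ n) (ht₁ n) (hu n) hp hq j
  obtain ⟨w, -, φ, hφ, hw⟩ := (isCompact_closedBall (0 : κ → ℝ) C).tendsto_subseq hbound
  have hlim : Filter.Tendsto (fun n => t (φ n) • shapley a (u (φ n))) Filter.atTop
      (nhds ((1 : ℝ) • shapley a w)) :=
    (htlim.comp hφ.tendsto_atTop).smul
      (((lipschitzWith_shapley a).continuous.tendsto w).comp hw)
  have hfix : shapley a w = w := by
    rw [one_smul] at hlim
    exact tendsto_nhds_unique hlim (hw.congr fun n => (hu (φ n)).symm)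
  exact hdep' w fun j => (congrFun hfix j).le

end Shapley

theorem exists_notMem_four (a b c d : Fin 5) : ∃ m, m ∉ ({a, b, c, d} : Finset (Fin 5)) := by
  by_contra! h
  have h₁ := Finset.card_le_card (fun k _ => h k : Finset.univ ⊆ ({a, b, c, d} : Finset (Fin 5)))
  have h₂ := Finset.card_le_four (a := a) (b := b) (c := c) (d := d)
  rw [Finset.card_univ, Fintype.card_fin] at h₁
  omega

theorem eq_or_eq_of_ne {a b c d e : Fin 5}
    (hab : a ≠ b) (hac : a ≠ c) (had : a ≠ d) (hae : a ≠ e) (hbc : b ≠ c) (hbd : b ≠ d)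
    (hbe : b ≠ e) (hcd : c ≠ d) (hce : c ≠ e) (hde : d ≠ e) (k : Fin 5) :
    k = a ∨ k = b ∨ k = c ∨ k = d ∨ k = e := by
  have h : Function.Injective ![a, b, c, d, e] := by
    intro i j
    fin_cases i <;> fin_cases j <;> simp_all [eq_comm]
  obtain ⟨i, rfl⟩ := Finite.injective_iff_surjective.1 h k
  fin_cases i <;> simp

/-- The minimum of `v k + x k` over `k ≠ i` is attained at least twice. -/
def TwiceMin (v x : Fin 5 → ℝ) (i : Fin 5) : Prop :=
  ∀ k, k ≠ i → ∃ l, l ≠ i ∧ l ≠ k ∧ v l + x l ≤ v k + x k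

/-- The minimum of `v k + x k` over `k ≠ i` is attained exactly at the `k ∉ {i, j, m}`. -/
def MinOff (v x : Fin 5 → ℝ) (i j m : Fin 5) : Prop :=
  ∀ k, k ≠ i → k ≠ j → k ≠ m →
    v k + x k < v j + x j ∧ v k + x k < v m + x m ∧
      ∀ l, l ≠ i → l ≠ j → l ≠ m → v k + x k = v l + x l

theorem TwiceMin.exists_or {v x : Fin 5 → ℝ} {i : Fin 5} (h : TwiceMin v x i) {a b c d : Fin 5}
    (cov : ∀ k, k = i ∨ k = a ∨ k = b ∨ k = c ∨ k = d) (ha : a ≠ i) :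
    (v b + x b ≤ v a + x a) ∨ (v c + x c ≤ v a + x a) ∨ (v d + x d ≤ v a + x a) := by
  obtain ⟨l, h₁, h₂, h₃⟩ := h a ha
  rcases cov l with rfl | rfl | rfl | rfl | rfl <;> simp_all

theorem MinOff.and {v x : Fin 5 → ℝ} {i j m a b : Fin 5} (h : MinOff v x i j m)
    (hai : a ≠ i := by grind) (haj : a ≠ j := by grind) (ham : a ≠ m := by grind)
    (hbi : b ≠ i := by grind) (hbj : b ≠ j := by grind) (hbm : b ≠ m := by grind) :
    v a + x a = v b + x b ∧ v a + x a < v j + x j ∧ v a + x a < v m + x m :=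
  ⟨(h a hai haj ham).2.2 b hbi hbj hbm, (h a hai haj ham).1, (h a hai haj ham).2.1⟩

/-- Three vectors on `Fin 5`, each ignoring one of the indices `a`, `b`, `c`, cannot attain their
minima in the prescribed pattern on three rows. -/
theorem false_of_minOff_triangle {va vb vc x y z : Fin 5 → ℝ} {a b c d e m' m'' : Fin 5}
    (hab : a ≠ b) (hac : a ≠ c) (had : a ≠ d) (hae : a ≠ e) (hbc : b ≠ c) (hbd : b ≠ d)
    (hbe : b ≠ e) (hcd : c ≠ d) (hce : c ≠ e) (hde : d ≠ e)
    (hm' : m' = d ∨ m' = e) (hm'' : m'' = a ∨ m'' = d ∨ m'' = e)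
    (hx : TwiceMin vc x c) (hy : TwiceMin vb y b) (hz : TwiceMin va z a)
    (hxa : MinOff va x a b e) (hxb : MinOff vb x b a e)
    (hya : MinOff va y a c m') (hyc : MinOff vc y c a m')
    (hzb : MinOff vb z b c m'') (hzc : MinOff vc z c b m'') : False := by
  have cov : ∀ k, k = a ∨ k = b ∨ k = c ∨ k = d ∨ k = e :=
    eq_or_eq_of_ne hab hac had hae hbc hbd hbe hcd hce hde
  have xd := hx.exists_or (a := d) (b := a) (c := b) (d := e)
    (fun k => by rcases cov k with h | h | h | h | h <;> simp [h]) hcd.symm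
  have yd := hy.exists_or (a := d) (b := a) (c := c) (d := e)
    (fun k => by rcases cov k with h | h | h | h | h <;> simp [h]) hbd.symm
  have ye := hy.exists_or (a := e) (b := a) (c := c) (d := d)
    (fun k => by rcases cov k with h | h | h | h | h <;> simp [h]) hbe.symm
  have zd := hz.exists_or (a := d) (b := b) (c := c) (d := e)
    (fun k => by rcases cov k with h | h | h | h | h <;> simp [h]) had.symm
  have ze := hz.exists_or (a := e) (b := b) (c := c) (d := d)
    (fun k => by rcases cov k with h | h | h | h | h <;> simp [h]) hae.symm
  obtain ⟨_, _, _⟩ := hxa.and (a := c) (b := d)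
  obtain ⟨_, _, _⟩ := hxb.and (a := c) (b := d)
  rcases hm' with rfl | rfl
  · obtain ⟨_, _, _⟩ := hya.and (a := b) (b := e)
    obtain ⟨_, _, _⟩ := hyc.and (a := b) (b := e)
    rcases hm'' with rfl | rfl | rfl
    · obtain ⟨_, _, _⟩ := hzb.and (a := m') (b := e)
      obtain ⟨_, _, _⟩ := hzc.and (a := m') (b := e)
      rcases xd with _ | _ | _
      · rcases ye with _ | _ | _ <;> rcases ze with _ | _ | _ <;> linarith
      · rcases zd with _ | _ | _ <;> linarith
      · linarith
    · obtain ⟨_, _, _⟩ := hzb.and (a := a) (b := e)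
      obtain ⟨_, _, _⟩ := hzc.and (a := a) (b := e)
      rcases ye with _ | _ | _ <;> rcases ze with _ | _ | _ <;> linarith
    · obtain ⟨_, _, _⟩ := hzb.and (a := a) (b := m')
      obtain ⟨_, _, _⟩ := hzc.and (a := a) (b := m')
      rcases xd with _ | _ | _ <;> rcases zd with _ | _ | _ <;> linarith
  · obtain ⟨_, _, _⟩ := hya.and (a := b) (b := d)
    obtain ⟨_, _, _⟩ := hyc.and (a := b) (b := d)
    rcases hm'' with rfl | rfl | rfl
    · obtain ⟨_, _, _⟩ := hzb.and (a := d) (b := m')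
      obtain ⟨_, _, _⟩ := hzc.and (a := d) (b := m')
      rcases xd with _ | _ | _ <;> rcases yd with _ | _ | _ <;> linarith
    · obtain ⟨_, _, _⟩ := hzb.and (a := a) (b := m')
      obtain ⟨_, _, _⟩ := hzc.and (a := a) (b := m')
      rcases xd with _ | _ | _ <;> rcases yd with _ | _ | _ <;> linarith
    · obtain ⟨_, _, _⟩ := hzb.and (a := a) (b := d)
      obtain ⟨_, _, _⟩ := hzc.and (a := a) (b := d)
      rcases xd with _ | _ | _ <;> rcases yd with _ | _ | _ <;> linarith

/-- Some row attains its minimum with respect to both `v i` and `v j` exactly off `{i, j, m}`. -/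
def Conflict {ι : Type*} (X : ι → Fin 5 → ℝ) (v : Fin 5 → Fin 5 → ℝ) (i j m : Fin 5) : Prop :=
  m ≠ i ∧ m ≠ j ∧ ∃ r, MinOff (v i) (X r) i j m ∧ MinOff (v j) (X r) j i m

theorem Conflict.symm {ι : Type*} {X : ι → Fin 5 → ℝ} {v : Fin 5 → Fin 5 → ℝ} {i j m : Fin 5}
    (h : Conflict X v i j m) : Conflict X v j i m :=
  ⟨h.2.1, h.1, h.2.2.imp fun _ h => h.symm⟩

theorem Conflict.eq_or_eq {ι : Type*} {X : ι → Fin 5 → ℝ} {v : Fin 5 → Fin 5 → ℝ}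
    (hT : ∀ r i, TwiceMin (v i) (X r) i) {a b c m m' m'' : Fin 5} (hab : a ≠ b) (hac : a ≠ c)
    (hbc : b ≠ c) (h : Conflict X v a b m) (h' : Conflict X v a c m') (h'' : Conflict X v b c m'') :
    m = c ∨ m' = b := by
  by_contra! ⟨hmc, hmb⟩
  obtain ⟨ma, mb, x, hxa, hxb⟩ := h
  obtain ⟨ma', mc', y, hya, hyc⟩ := h'
  obtain ⟨mb'', mc'', z, hzb, hzc⟩ := h''
  obtain ⟨d, hd⟩ := exists_notMem_four a b c m
  simp only [Finset.mem_insert, Finset.mem_singleton, not_or] at hd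
  obtain ⟨had, hbd, hcd, hdm⟩ := And.imp Ne.symm (And.imp Ne.symm (And.imp_left Ne.symm)) hd
  have cov := eq_or_eq_of_ne hab hac had ma.symm hbc hbd mb.symm hcd hmc.symm hdm
  have hm' : m' = d ∨ m' = m := by
    rcases cov m' with h | h | h | h | h <;> simp_all
  have hm'' : m'' = a ∨ m'' = d ∨ m'' = m := by
    rcases cov m'' with h | h | h | h | h <;> simp_all
  exact false_of_minOff_triangle hab hac had ma.symm hbc hbd mb.symm hcd hmc.symm hdm hm' hm''
    (hT x c) (hT y b) (hT z a) hxa hxb hya hyc hzb hzc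

theorem exists_forall_not_conflict {ι : Type*} {X : ι → Fin 5 → ℝ} {v : Fin 5 → Fin 5 → ℝ}
    (hT : ∀ r i, TwiceMin (v i) (X r) i) : ∃ i j, i ≠ j ∧ ∀ m, ¬ Conflict X v i j m := by
  by_contra! h
  choose! f hf using h
  have tri : ∀ a b c, a ≠ b → a ≠ c → b ≠ c → (f a b = c ∨ f a c = b) ∧ (f a b = c ∨ f b c = a) ∧
      (f a c = b ∨ f b c = a) := fun a b c hab hac hbc =>
    ⟨(hf a b hab).eq_or_eq hT hab hac hbc (hf a c hac) (hf b c hbc),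
      (hf a b hab).symm.eq_or_eq hT hab.symm hbc hac (hf b c hbc) (hf a c hac),
      (hf a c hac).symm.eq_or_eq hT hac.symm hbc.symm hab (hf b c hbc).symm (hf a b hab)⟩
  have h₁ := tri 0 1 2 (by decide) (by decide) (by decide)
  have h₂ := tri 0 1 3 (by decide) (by decide) (by decide)
  have h₃ := tri 0 2 3 (by decide) (by decide) (by decide)
  have h₄ := tri 1 2 3 (by decide) (by decide) (by decide)
  clear tri hf
  generalize f 0 1 = p at *
  generalize f 0 2 = q at *
  generalize f 0 3 = r at *
  generalize f 1 2 = s at *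
  generalize f 1 3 = t at *
  generalize f 2 3 = u at *
  clear hT
  omega

theorem finite_setOf_eq_sum {r : ℕ} (A : Matrix (Fin r) (Fin r) ℝ) :
    {v | ∃ σ : Equiv.Perm (Fin r), v = ∑ i, A i (σ i)}.Finite := by
  refine (Set.finite_range fun σ : Equiv.Perm (Fin r) => ∑ i, A i (σ i)).subset ?_
  rintro _ ⟨σ, rfl⟩
  exact ⟨σ, rfl⟩

theorem tropDet_le {r : ℕ} (A : Matrix (Fin r) (Fin r) ℝ) (σ : Equiv.Perm (Fin r)) :
    tropDet A ≤ ∑ i, A i (σ i) :=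
  csInf_le (finite_setOf_eq_sum A).bddBelow ⟨σ, rfl⟩

theorem exists_sum_eq_tropDet {r : ℕ} (A : Matrix (Fin r) (Fin r) ℝ) :
    ∃ σ : Equiv.Perm (Fin r), ∑ i, A i (σ i) = tropDet A := by
  have hne : {v | ∃ σ : Equiv.Perm (Fin r), v = ∑ i, A i (σ i)}.Nonempty := ⟨_, 1, rfl⟩
  obtain ⟨σ, hσ⟩ := hne.csInf_mem (finite_setOf_eq_sum A)
  exact ⟨σ, hσ.symm⟩

theorem not_tropSingular_of_dominant {r : ℕ} {A : Matrix (Fin r) (Fin r) ℝ} {v : Fin r → ℝ}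
    (h : ∀ j k, k ≠ j → A j j + v j < A j k + v k) : ¬ TropSingular A := by
  rintro ⟨σ, τ, hne, hσ, hτ⟩
  have key : ∀ σ : Equiv.Perm (Fin r), ∑ i, A i (σ i) = tropDet A → σ = 1 := by
    intro σ hσ
    by_contra hσ₁
    obtain ⟨j, hj⟩ : ∃ j, σ j ≠ j := by
      by_contra! h
      exact hσ₁ (Equiv.ext h)
    have h₁ : ∑ i, (A i i + v i) < ∑ i, (A i (σ i) + v (σ i)) := by
      refine Finset.sum_lt_sum (fun i _ => ?_) ⟨j, Finset.mem_univ j, h j _ hj⟩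
      rcases eq_or_ne (σ i) i with hi | hi
      · rw [hi]
      · exact (h i _ hi).le
    rw [Finset.sum_add_distrib, Finset.sum_add_distrib, Equiv.sum_comp σ v] at h₁
    have h₂ := tropDet_le A 1
    simp only [Equiv.Perm.coe_one, id_eq] at h₂
    linarith
  exact hne ((key σ hσ).trans (key τ hτ).symm)

theorem exists_twiceMin {g : ℕ} [Nonempty (Fin g)] {A : Matrix (Fin g) (Fin 5) ℝ}
    (h : ∀ (ri : Fin 4 → Fin g) (ci : Fin 4 → Fin 5), ri.Injective → ci.Injective →
      TropSingular (A.submatrix ri ci)) (i : Fin 5) :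
    ∃ v : Fin 5 → ℝ, ∀ r, TwiceMin v (A r) i := by
  rcases exists_dependency_or_exists_unique_min fun r (k : Fin 4) => A r (i.succAbove k) with
    ⟨v, hv⟩ | ⟨v, hv⟩
  · refine ⟨i.insertNth 0 v, fun r k hk => ?_⟩
    obtain ⟨k, rfl⟩ := Fin.exists_succAbove_eq hk
    obtain ⟨l, hl, hl'⟩ := hv r k
    refine ⟨i.succAbove l, Fin.succAbove_ne i l, fun h => hl (Fin.succAbove_right_injective h), ?_⟩
    simp only [Fin.insertNth_apply_succAbove]
    linarith
  · choose ri hri using hv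
    refine absurd (h ri i.succAbove (fun j k hjk => ?_) Fin.succAbove_right_injective)
      (not_tropSingular_of_dominant (v := v) fun j k hk => hri j k hk)
    by_contra hne
    have h₁ := hri j k (Ne.symm hne)
    have h₂ := hri k j hne
    rw [hjk] at h₁
    linarith

theorem bddAbove_tropRank_set {m n : ℕ} (M : Matrix (Fin m) (Fin n) ℝ) :
    BddAbove {r | ∃ ri : Fin r → Fin m, ∃ ci : Fin r → Fin n,
      Function.Injective ri ∧ Function.Injective ci ∧ ¬ TropSingular (M.submatrix ri ci)} := by
  refine ⟨n, ?_⟩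
  rintro r ⟨ri, ci, -, hci, -⟩
  simpa using Fintype.card_le_of_injective ci hci

theorem tropSingular_of_tropRank_lt {m n r : ℕ} {M : Matrix (Fin m) (Fin n) ℝ}
    (h : tropRank M < r) {ri : Fin r → Fin m} {ci : Fin r → Fin n} (hri : ri.Injective)
    (hci : ci.Injective) : TropSingular (M.submatrix ri ci) := by
  by_contra hs
  exact h.not_ge (le_csSup (bddAbove_tropRank_set M) ⟨ri, ci, hri, hci, hs⟩)

theorem exists_not_tropSingular {m n : ℕ} (M : Matrix (Fin m) (Fin n) ℝ) :
    ∃ (ri : Fin (tropRank M) → Fin m) (ci : Fin (tropRank M) → Fin n),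
      ri.Injective ∧ ci.Injective ∧ ¬ TropSingular (M.submatrix ri ci) := by
  refine Nat.sSup_mem (s := {r | ∃ ri : Fin r → Fin m, ∃ ci : Fin r → Fin n,
      Function.Injective ri ∧ Function.Injective ci ∧ ¬ TropSingular (M.submatrix ri ci)})
    ⟨0, Fin.elim0, Fin.elim0, fun i => i.elim0, fun i => i.elim0, ?_⟩ (bddAbove_tropRank_set M)
  rintro ⟨σ, τ, hne, -⟩
  exact hne (Subsingleton.elim σ τ)

theorem IsLift.prod_ne_zero {r : ℕ} {F : Matrix (Fin r) (Fin r) Ktilde}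
    {M : Matrix (Fin r) (Fin r) ℝ} (h : IsLift F M) (σ : Equiv.Perm (Fin r)) :
    ∏ i, F i (σ i) ≠ 0 :=
  Finset.prod_ne_zero_iff.2 fun i _ => (h i (σ i)).1

theorem order_prod {ι : Type*} (s : Finset ι) (f : ι → Ktilde) (hf : ∀ i, f i ≠ 0) :
    (∏ i ∈ s, f i).order = ∑ i ∈ s, (f i).order := by
  classical
  induction s using Finset.induction_on with
  | empty => simp
  | insert i s hi ih =>
    rw [Finset.prod_insert hi, Finset.sum_insert hi, HahnSeries.order_mul (hf i)
      (Finset.prod_ne_zero_iff.2 fun i _ => hf i), ih]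

theorem IsLift.det_ne_zero {r : ℕ} {F : Matrix (Fin r) (Fin r) Ktilde}
    {M : Matrix (Fin r) (Fin r) ℝ} (h : IsLift F M) (hM : ¬ TropSingular M) : F.det ≠ 0 := by
  obtain ⟨σ, hσ⟩ := exists_sum_eq_tropDet M
  have hord : ∀ τ : Equiv.Perm (Fin r), (∏ i, F i (τ i)).order = ∑ i, M i (τ i) := fun τ => by
    rw [order_prod _ _ fun i => (h i _).1]
    exact Finset.sum_congr rfl fun i _ => (h i _).2
  have hcoeff : F.det.coeff (tropDet M) =
      Equiv.Perm.sign σ • (∏ i, F i (σ i)).coeff (tropDet M) := by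
    rw [← Matrix.det_transpose, Matrix.det_apply, HahnSeries.coeff_sum,
      Finset.sum_eq_single_of_mem σ (Finset.mem_univ σ)]
    · rcases Int.units_eq_one_or (Equiv.Perm.sign σ) with hs | hs <;> simp [hs]
    · intro τ _ hτ
      have hlt : tropDet M < ∑ i, M i (τ i) :=
        (tropDet_le M τ).lt_of_ne fun heq => hM ⟨τ, σ, hτ, heq.symm, hσ⟩
      have h₀ : (∏ i, F i (τ i)).coeff (tropDet M) = 0 :=
        HahnSeries.coeff_eq_zero_of_lt_order (by rwa [hord])
      rcases Int.units_eq_one_or (Equiv.Perm.sign τ) with hs | hs <;> simp [hs, h₀]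
  intro hdet
  rw [hdet, HahnSeries.coeff_zero, ← hσ, ← hord σ] at hcoeff
  have := h.prod_ne_zero σ
  rw [← HahnSeries.leadingCoeff_ne_zero, HahnSeries.leadingCoeff_eq] at this
  rcases Int.units_eq_one_or (Equiv.Perm.sign σ) with hs | hs <;> simp_all [Units.smul_def]

theorem IsLift.tropRank_le_rank {m n : ℕ} {F : Matrix (Fin m) (Fin n) Ktilde}
    {M : Matrix (Fin m) (Fin n) ℝ} (h : IsLift F M) : tropRank M ≤ F.rank := by
  obtain ⟨ri, ci, -, -, hs⟩ := exists_not_tropSingular M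
  have hdet : (F.submatrix ri ci).det ≠ 0 :=
    IsLift.det_ne_zero (M := M.submatrix ri ci) (fun i j => h (ri i) (ci j)) hs
  have := Matrix.rank_of_det_ne_zero hdet
  rw [Fintype.card_fin] at this
  rw [← this]
  exact Matrix.rank_submatrix_le F ri ci

/-- The generalized Puiseux series `x` has nonnegative order and constant term `c`. -/
def HasResidue (x : Ktilde) (c : ℂ) : Prop :=
  0 < (x - HahnSeries.C c).orderTop

theorem orderTop_add_pos {x y : Ktilde} (hx : 0 < x.orderTop) (hy : 0 < y.orderTop) :
    0 < (x + y).orderTop :=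
  (lt_min hx hy).trans_le HahnSeries.min_orderTop_le_orderTop_add

theorem orderTop_mul_pos {x y : Ktilde} (hx : 0 < x.orderTop) (hy : 0 ≤ y.orderTop) :
    0 < (x * y).orderTop := by
  rw [HahnSeries.orderTop_mul]
  exact add_pos_of_pos_of_nonneg hx hy

theorem orderTop_C_nonneg (c : ℂ) : 0 ≤ (HahnSeries.C c : Ktilde).orderTop := by
  rw [HahnSeries.C_apply]
  exact HahnSeries.orderTop_single_le

namespace HasResidue

variable {x y : Ktilde} {c d : ℂ}

theorem zero : HasResidue 0 0 := by simp [HasResidue]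

theorem C (c : ℂ) : HasResidue (HahnSeries.C c) c := by simp [HasResidue]

theorem neg (hx : HasResidue x c) : HasResidue (-x) (-c) := by
  have h : -x - HahnSeries.C (-c) = -(x - HahnSeries.C c) := by rw [map_neg]; ring
  rw [HasResidue, h, HahnSeries.orderTop_neg]
  exact hx

theorem add (hx : HasResidue x c) (hy : HasResidue y d) : HasResidue (x + y) (c + d) := by
  have h : x + y - HahnSeries.C (c + d) = (x - HahnSeries.C c) + (y - HahnSeries.C d) := by
    rw [map_add]; ring
  rw [HasResidue, h]
  exact orderTop_add_pos hx hy

theorem sub (hx : HasResidue x c) (hy : HasResidue y d) : HasResidue (x - y) (c - d) := by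
  rw [sub_eq_add_neg, sub_eq_add_neg]
  exact hx.add hy.neg

theorem mul (hx : HasResidue x c) (hy : HasResidue y d) : HasResidue (x * y) (c * d) := by
  have h : x * y - HahnSeries.C (c * d) =
      (x - HahnSeries.C c) * (y - HahnSeries.C d) + ((y - HahnSeries.C d) * HahnSeries.C c +
        (x - HahnSeries.C c) * HahnSeries.C d) := by
    rw [map_mul]; ring
  rw [HasResidue, h]
  exact orderTop_add_pos (orderTop_mul_pos hx hy.le)
    (orderTop_add_pos (orderTop_mul_pos hy (orderTop_C_nonneg c))
      (orderTop_mul_pos hx (orderTop_C_nonneg d)))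

theorem sum {ι : Type*} {s : Finset ι} {f : ι → Ktilde} {r : ι → ℂ}
    (h : ∀ a, HasResidue (f a) (r a)) : HasResidue (∑ a ∈ s, f a) (∑ a ∈ s, r a) := by
  induction s using Finset.induction_on with
  | empty => simpa using zero
  | insert i s hi ih => rw [Finset.sum_insert hi, Finset.sum_insert hi]; exact (h i).add ih

theorem single {t : ℝ} (ht : 0 ≤ t) (c : ℂ) :
    HasResidue (HahnSeries.single t c) (if t = 0 then c else 0) := by
  rcases ht.eq_or_lt with rfl | ht
  · simpa using C c
  · rw [if_neg ht.ne', HasResidue, map_zero, sub_zero]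
    exact HahnSeries.lt_orderTop_single ht

theorem orderTop_eq_zero (hx : HasResidue x c) (hc : c ≠ 0) : x.orderTop = 0 := by
  have h₁ : (HahnSeries.C c : Ktilde).orderTop = 0 := by
    rw [HahnSeries.C_apply, HahnSeries.orderTop_single hc]; rfl
  have h₂ := HahnSeries.orderTop_add_eq_left (x := HahnSeries.C c) (y := x - HahnSeries.C c)
    (by rw [h₁]; exact hx)
  rwa [add_sub_cancel, h₁] at h₂

end HasResidue

theorem exists_orthogonal_of_residues {ι : Type*} [Fintype ι] {E G : ι → Ktilde} {r s c : ι → ℂ}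
    (hE : ∀ a, HasResidue (E a) (r a)) (hG : ∀ a, HasResidue (G a) (s a))
    (hr : ∑ a, r a * c a = 0) (hs : ∑ a, s a * c a = 0) (hc : ∀ a, c a ≠ 0) {p q : ι}
    (hpq : r p * s q - r q * s p ≠ 0) :
    ∃ y : ι → Ktilde, (∀ a, (y a).orderTop = 0) ∧ ∑ a, E a * y a = 0 ∧ ∑ a, G a * y a = 0 := by
  set D := E p * G q - E q * G p with hD
  set ε := ∑ a, E a * HahnSeries.C (c a) with hε
  set η := ∑ a, G a * HahnSeries.C (c a) with hη
  have hε₀ : HasResidue ε 0 := hr ▸ HasResidue.sum fun a => (hE a).mul (HasResidue.C (c a))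
  have hη₀ : HasResidue η 0 := hs ▸ HasResidue.sum fun a => (hG a).mul (HasResidue.C (c a))
  have hu : HasResidue (G q * ε - E q * η) 0 := by
    simpa using ((hG q).mul hε₀).sub ((hE q).mul hη₀)
  have hw : HasResidue (E p * η - G p * ε) 0 := by
    simpa using ((hE p).mul hη₀).sub ((hG p).mul hε₀)
  have hsum : ∀ f : ι → Ktilde, ∑ a, f a * (D * HahnSeries.C (c a) -
      ((if a = p then G q * ε - E q * η else 0) + if a = q then E p * η - G p * ε else 0)) =
      D * (∑ a, f a * HahnSeries.C (c a)) -
        (f p * (G q * ε - E q * η) + f q * (E p * η - G p * ε)) := fun f => by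
    simp only [mul_sub, mul_add, Finset.sum_sub_distrib, Finset.sum_add_distrib, mul_ite, mul_zero,
      Finset.sum_ite_eq', Finset.mem_univ, if_true, Finset.mul_sum]
    simp only [mul_left_comm D]
  refine ⟨fun a => D * HahnSeries.C (c a) -
      ((if a = p then G q * ε - E q * η else 0) + if a = q then E p * η - G p * ε else 0),
    fun a => ?_, ?_, ?_⟩
  · refine HasResidue.orderTop_eq_zero (c := (r p * s q - r q * s p) * c a) ?_
      (mul_ne_zero hpq (hc a))
    have h := ((((hE p).mul (hG q)).sub ((hE q).mul (hG p))).mul (HasResidue.C (c a))).sub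
      (HasResidue.add (c := 0) (d := 0)
        (x := if a = p then G q * ε - E q * η else 0) (y := if a = q then E p * η - G p * ε else 0)
        (by split_ifs; exacts [hu, HasResidue.zero]) (by split_ifs; exacts [hw, HasResidue.zero]))
    simpa using h
  · rw [hsum, ← hε, hD]; ring
  · rw [hsum, ← hη, hD]; ring

theorem exists_forall_ne_zero_of_not_exists {ι : Type*} [Fintype ι] {r s : ι → ℂ}
    (h : ∀ d, ¬ ∃ l m : ℂ, ∀ b, (if b = d then 1 else 0) = l * r b + m * s b) :
    ∃ c : ι → ℂ, ∑ a, r a * c a = 0 ∧ ∑ a, s a * c a = 0 ∧ ∀ a, c a ≠ 0 := by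
  let L : Fin 2 → (ι → ℂ) →ₗ[ℂ] ℂ := ![Fintype.linearCombination ℂ r, Fintype.linearCombination ℂ s]
  obtain ⟨c, hc, hc'⟩ := Module.Dual.exists_forall_mem_ne_zero_of_forall_exists
    (⨅ k, LinearMap.ker (L k)) (fun d : ι => LinearMap.proj (φ := fun _ => ℂ) (R := ℂ) d) (by
      intro d
      by_contra! hd
      refine h d ?_
      have hmem := mem_span_of_iInf_ker_le_ker (𝕜 := ℂ) (L := L)
        (K := LinearMap.proj (φ := fun _ => ℂ) (R := ℂ) d) fun x hx => hd x hx
      obtain ⟨k, hk⟩ := (Submodule.mem_span_range_iff_exists_fun ℂ).1 hmem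
      refine ⟨k 0, k 1, fun b => ?_⟩
      have := LinearMap.congr_fun hk (Pi.single b 1)
      simpa [L, Fin.sum_univ_two, Pi.single_apply, eq_comm] using this.symm)
  simp only [Submodule.mem_iInf, LinearMap.mem_ker, Fin.forall_fin_two] at hc
  refine ⟨c, ?_, ?_, hc'⟩
  · simpa [L, Fintype.linearCombination_apply, mul_comm] using hc.1
  · simpa [L, Fintype.linearCombination_apply, mul_comm] using hc.2

theorem not_exists_combination {ι : Type*} {M N : ι → Prop} [DecidablePred M] [DecidablePred N]
    {β : ι → ℂ}
    (hβ : Function.Injective β) (hβ₀ : ∀ a, β a ≠ 0) (hM : ∀ a, ∃ b, b ≠ a ∧ M b)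
    (hN : ∀ a, ∃ b, b ≠ a ∧ N b)
    (hMN : ¬ ∃ d b, d ≠ b ∧ ∀ a, (M a ↔ a = d ∨ a = b) ∧ (N a ↔ a = d ∨ a = b)) (d : ι) :
    ¬ ∃ l m : ℂ, ∀ b, (if b = d then 1 else 0) =
      l * (if M b then 1 else 0) + m * (if N b then β b else 0) := by
  rintro ⟨l, m, h⟩
  have hd := h d
  rw [if_pos rfl] at hd
  obtain ⟨b, hbd, hb⟩ := hM d
  obtain ⟨b', hbd', hb'⟩ := hN d
  have hl : l ≠ 0 := by
    rintro rfl
    have h₁ := h b'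
    rw [if_neg hbd', if_pos hb', zero_mul, zero_add, eq_comm, mul_eq_zero] at h₁
    rw [h₁.resolve_right (hβ₀ b'), zero_mul, zero_mul, add_zero] at hd
    exact one_ne_zero hd
  have hm : m ≠ 0 := by
    rintro rfl
    have h₁ := h b
    rw [if_neg hbd, if_pos hb, zero_mul, add_zero, mul_one] at h₁
    exact hl h₁.symm
  have key : ∀ a, a ≠ d → (M a ∨ N a) → M a ∧ N a ∧ l + m * β a = 0 := by
    intro a had ha
    have h₁ := h a
    rw [if_neg had] at h₁
    by_cases hMa : M a <;> by_cases hNa : N a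
    · rw [if_pos hMa, if_pos hNa, mul_one] at h₁
      exact ⟨hMa, hNa, h₁.symm⟩
    · rw [if_pos hMa, if_neg hNa, mul_one, mul_zero, add_zero] at h₁
      exact absurd h₁.symm hl
    · rw [if_neg hMa, if_pos hNa, mul_zero, zero_add] at h₁
      exact absurd h₁.symm (mul_ne_zero hm (hβ₀ a))
    · exact absurd ha (not_or.2 ⟨hMa, hNa⟩)
  have hb₁ := key b hbd (Or.inl hb)
  have huniq : ∀ a, a ≠ d → (M a ∨ N a) → a = b := by
    intro a had ha
    refine hβ (mul_left_cancel₀ hm ?_)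
    linear_combination (key a had ha).2.2 - hb₁.2.2
  obtain ⟨a, hab, ha⟩ := hM b
  obtain ⟨a', hab', ha'⟩ := hN b
  have had : a = d := by
    by_contra had
    exact hab (huniq a had (Or.inl ha))
  have had' : a' = d := by
    by_contra had
    exact hab' (huniq a' had (Or.inr ha'))
  refine hMN ⟨d, b, hbd.symm, fun k => ⟨⟨fun hk => ?_, ?_⟩, fun hk => ?_, ?_⟩⟩
  · exact or_iff_not_imp_left.2 fun hkd => huniq k hkd (Or.inl hk)
  · rintro (rfl | rfl)
    exacts [had ▸ ha, hb]
  · exact or_iff_not_imp_left.2 fun hkd => huniq k hkd (Or.inr hk)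
  · rintro (rfl | rfl)
    exacts [had' ▸ ha', hb₁.2.1]

theorem exists_minor_ne_zero {ι : Type*} {M N : ι → Prop} [DecidablePred M] [DecidablePred N]
    {β : ι → ℂ}
    (hβ : Function.Injective β) (hβ₀ : ∀ a, β a ≠ 0) (hM : ∀ a, ∃ b, b ≠ a ∧ M b)
    (hN : ∃ b, N b) : ∃ p q : ι, (if M p then (1 : ℂ) else 0) * (if N q then β q else 0) -
      (if M q then 1 else 0) * (if N p then β p else 0) ≠ 0 := by
  by_contra! h
  obtain ⟨b, hb⟩ := hN
  obtain ⟨p, -, hp⟩ := hM b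
  obtain ⟨q, hqp, hq⟩ := hM p
  have h₁ := h p b
  have h₂ := h q p
  rw [if_pos hp, if_pos hb] at h₁
  rw [if_pos hq, if_pos hp] at h₂
  have hNp : N p := by
    by_contra hNp
    simp_all
  by_cases hNq : N q
  · rw [if_pos hNp, if_pos hNq] at h₂
    exact hqp (hβ (by linear_combination -h₂))
  · rw [if_pos hNp, if_neg hNq] at h₂
    simp_all

/-- The linear form with coefficients of orders `v` and leading coefficients `α`, except that the
coefficient of index `i` vanishes. -/
def lineForm (v : Fin 5 → ℝ) (α : Fin 5 → ℂ) (i a : Fin 5) : Ktilde :=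
  if a = i then 0 else HahnSeries.single (v a) (α a)

theorem exists_min_of_twiceMin {v x : Fin 5 → ℝ} {i : Fin 5} (h : TwiceMin v x i) :
    ∃ μ : ℝ, (∀ a, a ≠ i → μ ≤ v a + x a) ∧ ∀ a, ∃ b, b ≠ a ∧ b ≠ i ∧ v b + x b = μ := by
  obtain ⟨k, hk, hmin⟩ := Finset.exists_min_image (Finset.univ.erase i) (fun a => v a + x a)
    Finset.univ_nontrivial.erase_nonempty
  simp only [Finset.mem_erase, Finset.mem_univ, and_true] at hk hmin
  refine ⟨v k + x k, hmin, fun a => ?_⟩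
  obtain ⟨l, hli, hlk, hl⟩ := h k hk
  rcases eq_or_ne k a with rfl | hka
  · exact ⟨l, hlk, hli, hl.antisymm (hmin l hli)⟩
  · exact ⟨k, hka, hk, rfl⟩

theorem exists_label {i j d b : Fin 5} (hij : i ≠ j) (hdb : d ≠ b) (hdi : d ≠ i) (hdj : d ≠ j)
    (hbi : b ≠ i) (hbj : b ≠ j) :
    ∃ m, m ≠ i ∧ m ≠ j ∧ m ≠ d ∧ m ≠ b ∧ ∀ k, k ≠ i → k ≠ j → k ≠ m → k = d ∨ k = b := by
  obtain ⟨m, hm⟩ := exists_notMem_four i j d b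
  simp only [Finset.mem_insert, Finset.mem_singleton, not_or] at hm
  obtain ⟨hmi, hmj, hmd, hmb⟩ := hm
  refine ⟨m, hmi, hmj, hmd, hmb, fun k hki hkj hkm => ?_⟩
  rcases eq_or_eq_of_ne hij hdi.symm hbi.symm (Ne.symm hmi) hdj.symm hbj.symm (Ne.symm hmj) hdb
    (Ne.symm hmd) (Ne.symm hmb) k with h | h | h | h | h
  exacts [absurd h hki, absurd h hkj, Or.inl h, Or.inr h, absurd h hkm]

theorem minOff_of_iff {v x : Fin 5 → ℝ} {i j m d b : Fin 5} {μ : ℝ}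
    (hμ : ∀ a, a ≠ i → μ ≤ v a + x a)
    (hM : ∀ a, (a ≠ i ∧ v a + x a = μ) ↔ a = d ∨ a = b) (hij : i ≠ j) (hmi : m ≠ i) (hmd : m ≠ d)
    (hmb : m ≠ b) (hdj : d ≠ j) (hbj : b ≠ j)
    (hm : ∀ k, k ≠ i → k ≠ j → k ≠ m → k = d ∨ k = b) : MinOff v x i j m := by
  have hlt : ∀ a, a ≠ i → a ≠ d → a ≠ b → μ < v a + x a := fun a hai had hab =>
    (hμ a hai).lt_of_ne fun h => ((hM a).1 ⟨hai, h.symm⟩).elim had hab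
  intro k hki hkj hkm
  rw [((hM k).2 (hm k hki hkj hkm)).2]
  refine ⟨hlt j hij.symm hdj.symm hbj.symm, hlt m hmi hmd hmb, fun l hli hlj hlm => ?_⟩
  rw [((hM l).2 (hm l hli hlj hlm)).2]

theorem sum_lineForm_mul (v x : Fin 5 → ℝ) (α : Fin 5 → ℂ) (i : Fin 5) (μ : ℝ)
    (y : Fin 5 → Ktilde) :
    ∑ a, (HahnSeries.single (x a) 1 * y a) * lineForm v α i a =
      HahnSeries.single μ 1 * ∑ a, lineForm (fun a => v a + x a - μ) α i a * y a := by
  rw [Finset.mul_sum]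
  refine Finset.sum_congr rfl fun a _ => ?_
  unfold lineForm
  split_ifs
  · simp
  · rw [← mul_assoc, HahnSeries.single_mul_single, mul_right_comm, HahnSeries.single_mul_single]
    congr 3
    ring

theorem hasResidue_lineForm {v x : Fin 5 → ℝ} (α : Fin 5 → ℂ) {i : Fin 5} {μ : ℝ}
    (hμ : ∀ a, a ≠ i → μ ≤ v a + x a) (a : Fin 5) :
    HasResidue (lineForm (fun a => v a + x a - μ) α i a)
      (if a ≠ i ∧ v a + x a = μ then α a else 0) := by
  unfold lineForm
  split_ifs with h₁ h₂ h₂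
  · exact absurd h₁ h₂.1
  · exact HasResidue.zero
  · have := HasResidue.single (sub_nonneg.2 (hμ a h₁)) (α a)
    rwa [if_pos (by linarith [h₂.2])] at this
  · have := HasResidue.single (sub_nonneg.2 (hμ a h₁)) (α a)
    rwa [if_neg fun h => h₂ ⟨h₁, by linarith⟩] at this

theorem exists_row_lift {β : Fin 5 → ℂ} (hβ : Function.Injective β) (hβ₀ : ∀ a, β a ≠ 0)
    {v w x : Fin 5 → ℝ} {i j : Fin 5} (hij : i ≠ j) (hv : TwiceMin v x i) (hw : TwiceMin w x j)
    (hnc : ∀ m, m ≠ i → m ≠ j → MinOff v x i j m → ¬ MinOff w x j i m) :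
    ∃ X : Fin 5 → Ktilde, (∀ a, X a ≠ 0 ∧ ord (X a) = x a) ∧
      ∑ a, X a * lineForm v (fun _ => 1) i a = 0 ∧ ∑ a, X a * lineForm w β j a = 0 := by
  obtain ⟨μ, hμ, hM⟩ := exists_min_of_twiceMin hv
  obtain ⟨ν, hν, hN⟩ := exists_min_of_twiceMin hw
  have hMN : ¬ ∃ d b, d ≠ b ∧ ∀ a, ((a ≠ i ∧ v a + x a = μ) ↔ a = d ∨ a = b) ∧
      ((a ≠ j ∧ w a + x a = ν) ↔ a = d ∨ a = b) := by
    rintro ⟨d, b, hdb, h⟩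
    have hdi := ((h d).1.2 (Or.inl rfl)).1
    have hdj := ((h d).2.2 (Or.inl rfl)).1
    have hbi := ((h b).1.2 (Or.inr rfl)).1
    have hbj := ((h b).2.2 (Or.inr rfl)).1
    obtain ⟨m, hmi, hmj, hmd, hmb, hm⟩ := exists_label hij hdb hdi hdj hbi hbj
    exact hnc m hmi hmj (minOff_of_iff hμ (fun a => (h a).1) hij hmi hmd hmb hdj hbj hm)
      (minOff_of_iff hν (fun a => (h a).2) hij.symm hmj hmd hmb hdi hbi
        fun k hkj hki => hm k hki hkj)
  obtain ⟨c, hc₁, hc₂, hc⟩ := exists_forall_ne_zero_of_not_exists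
    (not_exists_combination hβ hβ₀ hM hN hMN)
  obtain ⟨p, q, hpq⟩ := exists_minor_ne_zero hβ hβ₀ hM ((hN i).imp fun _ h => h.2)
  obtain ⟨y, hy, hy₁, hy₂⟩ := exists_orthogonal_of_residues (hasResidue_lineForm (fun _ => 1) hμ)
    (hasResidue_lineForm β hν) hc₁ hc₂ hc hpq
  have hX : ∀ a, (HahnSeries.single (x a) (1 : ℂ) * y a).orderTop = x a := fun a => by
    rw [HahnSeries.orderTop_mul, hy, HahnSeries.orderTop_single one_ne_zero, add_zero]
  refine ⟨fun a => HahnSeries.single (x a) 1 * y a, fun a => ?_, ?_, ?_⟩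
  · have h₀ : HahnSeries.single (x a) (1 : ℂ) * y a ≠ 0 :=
      HahnSeries.orderTop_ne_top.1 (by rw [hX]; exact WithTop.coe_ne_top)
    refine ⟨h₀, WithTop.coe_injective ?_⟩
    rw [ord, HahnSeries.order_eq_orderTop_of_ne_zero h₀, hX]
  · rw [sum_lineForm_mul v x (fun _ => 1) i μ y, hy₁, mul_zero]
  · rw [sum_lineForm_mul w x β j ν y, hy₂, mul_zero]

theorem exists_isLift_rank_le {g : ℕ} {A : Matrix (Fin g) (Fin 5) ℝ} {v w : Fin 5 → ℝ}
    {i j : Fin 5} (hij : i ≠ j) (hv : ∀ r, TwiceMin v (A r) i) (hw : ∀ r, TwiceMin w (A r) j)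
    (hnc : ∀ r m, m ≠ i → m ≠ j → MinOff v (A r) i j m → ¬ MinOff w (A r) j i m) :
    ∃ F : Matrix (Fin g) (Fin 5) Ktilde, IsLift F A ∧ F.rank ≤ 3 := by
  let β : Fin 5 → ℂ := fun a => (a : ℕ) + 1
  have hβ : Function.Injective β := fun a b h => Fin.ext (by simpa [β] using h)
  have hβ₀ : ∀ a, β a ≠ 0 := fun a => Nat.cast_add_one_ne_zero _
  choose F hF hF₁ hF₂ using fun r => exists_row_lift hβ hβ₀ hij (hv r) (hw r) (hnc r)
  refine ⟨Matrix.of F, hF, ?_⟩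
  let L : Matrix (Fin 5) (Fin 2) Ktilde := Matrix.of fun a =>
    ![lineForm v (fun _ => 1) i a, lineForm w β j a]
  have hFL : Matrix.of F * L = 0 := by
    ext r k : 2
    fin_cases k
    · simpa [Matrix.mul_apply, L] using hF₁ r
    · simpa [Matrix.mul_apply, L] using hF₂ r
  have hL : (L.submatrix ![i, j] id).det ≠ 0 := by
    rw [Matrix.det_fin_two]
    simp [L, lineForm, hij, hij.symm, hβ₀]
  have h₁ := Matrix.rank_of_det_ne_zero hL
  have h₂ := Matrix.rank_submatrix_le L ![i, j] id
  have h₃ := Matrix.rank_add_rank_le_card_of_mul_eq_zero hFL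
  rw [Fintype.card_fin] at h₁ h₃
  omega

theorem kapRank_eq_three_of_tropRank_three {g : ℕ}
    (A : Matrix (Fin g) (Fin 5) ℝ) (h : tropRank A = 3) :
    kapRank A = 3 := by
  have : Nonempty (Fin g) := by
    obtain ⟨ri, -⟩ := exists_not_tropSingular A
    rw [h] at ri
    exact ⟨ri 0⟩
  choose v hv using exists_twiceMin (A := A) fun ri ci hri hci =>
    tropSingular_of_tropRank_lt (by omega) hri hci
  obtain ⟨i, j, hij, hnc⟩ := exists_forall_not_conflict fun r i => hv i r
  obtain ⟨F, hF⟩ := exists_isLift_rank_le hij (hv i) (hv j)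
    fun r m hmi hmj h₁ h₂ => hnc m ⟨hmi, hmj, r, h₁, h₂⟩
  refine le_antisymm (Nat.sInf_le ⟨F, hF⟩) (le_csInf ⟨3, F, hF⟩ ?_)
  rintro r ⟨G, hG, hGr⟩
  exact (h.symm.le.trans hG.tropRank_le_rank).trans hGr
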